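/- (Corollary 1) Consider the distributed gradient-tracking algorithm with each f_i convex and β-smooth (β > 0), and suppose f attains its minimum f* at some point x*. If 0 < η ≤ (1−σ)²/(160β), then for every agent i and every t ≥ 0, the running average x̂_i(t+1) = (1/(t+1)) Σ_{k=0}^{t} x_i(k+1) satisfies f(x̂_i(t+1)) − f* ≤ (1/(t+1)) · { n‖x̄(0) − x*‖²/(2η) + (36β/(1−σ)²) · [ (1/β)‖s(0) − 𝟙g(0)‖ + 2‖x(0) − 𝟙x̄(0)‖ ]² }. -/

import Mathlib

open scoped BigOperators RealInnerProductSpace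
open Filter

noncomputable section

abbrev Vec (N : ℕ) := EuclideanSpace ℝ (Fin N)

/-- Frobenius norm of a stacked matrix in `ℝ^{n×N}`, viewed as `n` rows in `ℝ^N`. -/
def fro {n N : ℕ} (A : Fin n → Vec N) : ℝ := Real.sqrt (∑ i, ‖A i‖ ^ 2)

/-- Spectral norm (largest singular value) of a square real matrix, as the operator norm
of the induced linear map between Euclidean spaces. -/
def specNorm {n : ℕ} (M : Matrix (Fin n) (Fin n) ℝ) : ℝ :=
  ‖LinearMap.toContinuousLinearMap (Matrix.toEuclideanLin M)‖

section Smooth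

variable {E : Type*} [NormedAddCommGroup E] [InnerProductSpace ℝ E] [CompleteSpace E]

lemma hasDerivAt_comp_line {f : E → ℝ} (hf : Differentiable ℝ f) (v d : E) (r : ℝ) :
    HasDerivAt (fun τ : ℝ => f (v + τ • d)) ⟪gradient f (v + r • d), d⟫ r := by
  have h := (hf (v + r • d)).hasGradientAt.hasFDerivAt
  have hl : HasDerivAt (fun τ : ℝ => v + τ • d) d r := by
    simpa using ((hasDerivAt_id r).smul_const d).const_add v
  exact h.comp_hasDerivAt r hl

lemma ConvexOn.add_inner_gradient_le {f : E → ℝ} (hc : ConvexOn ℝ Set.univ f)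
    (hf : Differentiable ℝ f) (v w : E) :
    f v + ⟪gradient f v, w - v⟫ ≤ f w := by
  have hφ : ConvexOn ℝ Set.univ (fun τ : ℝ => f (v + τ • (w - v))) := by
    have h := hc.comp_affineMap (AffineMap.lineMap v w : ℝ →ᵃ[ℝ] E)
    simpa [Function.comp_def, AffineMap.lineMap_apply, add_comm] using h
  have h := hφ.le_slope_of_hasDerivAt (Set.mem_univ 0) (Set.mem_univ 1) one_pos
    (hasDerivAt_comp_line hf v (w - v) 0)
  simp only [slope_def_field, zero_smul, one_smul, add_zero, add_sub_cancel, sub_zero, div_one] at h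
  linarith

lemma le_add_inner_gradient_add_sq {f : E → ℝ} (hf : Differentiable ℝ f) {β : ℝ}
    (hs : ∀ u v, ‖gradient f u - gradient f v‖ ≤ β * ‖u - v‖) (v w : E) :
    f w ≤ f v + ⟪gradient f v, w - v⟫ + β / 2 * ‖w - v‖ ^ 2 := by
  set d := w - v with hd
  have hder (r : ℝ) : HasDerivAt
      (fun τ : ℝ => f (v + τ • d) - (τ * ⟪gradient f v, d⟫ + τ ^ 2 * (β / 2 * ‖d‖ ^ 2)))
      (⟪gradient f (v + r • d), d⟫ - (⟪gradient f v, d⟫ + 2 * r * (β / 2 * ‖d‖ ^ 2))) r := by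
    refine (hasDerivAt_comp_line hf v d r).sub (HasDerivAt.add ?_ ?_)
    · simpa using (hasDerivAt_id r).mul_const ⟪gradient f v, d⟫
    · simpa using (hasDerivAt_pow 2 r).mul_const (β / 2 * ‖d‖ ^ 2)
  have hanti := antitoneOn_of_deriv_nonpos (convex_Icc (0 : ℝ) 1)
    (fun r _ => (hder r).continuousAt.continuousWithinAt)
    (fun r _ => (hder r).differentiableAt.differentiableWithinAt) (fun r hr => by
      rw [(hder r).deriv]
      rw [interior_Icc] at hr
      have h1 := real_inner_le_norm (gradient f (v + r • d) - gradient f v) d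
      have h2 := hs (v + r • d) v
      rw [inner_sub_left] at h1
      rw [add_sub_cancel_left, norm_smul, Real.norm_of_nonneg hr.1.le] at h2
      nlinarith [mul_le_mul_of_nonneg_right h2 (norm_nonneg d)])
  have h := hanti (Set.left_mem_Icc.2 zero_le_one) (Set.right_mem_Icc.2 zero_le_one) zero_le_one
  simp only [one_smul, zero_smul, add_zero] at h
  rw [show v + d = w by simp [hd]] at h
  linarith

omit [CompleteSpace E] in
/-- Moving a smooth function away from `z` costs at most twice its suboptimality gap at `z`,
plus a quadratic term. -/
lemma sub_min_le_two_mul_add_sq {F : E → ℝ} {β : ℝ} (hβ : 0 < β) {z p : E}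
    (hF : ∀ w, F w ≤ F z + ⟪p, w - z⟫ + β / 2 * ‖w - z‖ ^ 2) {m : ℝ} (hm : ∀ w, m ≤ F w)
    (y : E) : F y - m ≤ 2 * (F z - m) + β * ‖y - z‖ ^ 2 := by
  have h1 := (hm _).trans (hF (z - β⁻¹ • p))
  have h2 := hF y
  rw [sub_sub_cancel_left, inner_neg_right, real_inner_smul_right, real_inner_self_eq_norm_sq,
    norm_neg, norm_smul, mul_pow, Real.norm_of_nonneg (by positivity)] at h1
  have h3 : β / 2 * (β⁻¹ ^ 2 * ‖p‖ ^ 2) = β⁻¹ * ‖p‖ ^ 2 / 2 := by field_simp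
  have h4 : ⟪p, y - z⟫ ≤ β⁻¹ * ‖p‖ ^ 2 / 2 + β / 2 * ‖y - z‖ ^ 2 := by
    have h5 := real_inner_le_norm p (y - z)
    have h6 : β⁻¹ * ‖p‖ ^ 2 / 2 + β / 2 * ‖y - z‖ ^ 2 - ‖p‖ * ‖y - z‖ =
        β⁻¹ / 2 * (‖p‖ - β * ‖y - z‖) ^ 2 := by
      field_simp
      ring
    have h7 : 0 ≤ β⁻¹ / 2 * (‖p‖ - β * ‖y - z‖) ^ 2 := by positivity
    linarith
  linarith

end Smooth

section Frobenius

variable {n N : ℕ}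

lemma fro_eq_norm (A : Fin n → Vec N) : fro A = ‖WithLp.toLp 2 A‖ := by
  rw [PiLp.norm_eq_of_L2]; rfl

lemma fro_nonneg (A : Fin n → Vec N) : 0 ≤ fro A := Real.sqrt_nonneg _

lemma fro_sq (A : Fin n → Vec N) : fro A ^ 2 = ∑ i, ‖A i‖ ^ 2 :=
  Real.sq_sqrt (by positivity)

lemma fro_add_le (A B : Fin n → Vec N) : fro (fun i => A i + B i) ≤ fro A + fro B := by
  simp only [fro_eq_norm]
  exact norm_add_le (WithLp.toLp 2 A) (WithLp.toLp 2 B)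

lemma fro_smul (c : ℝ) (A : Fin n → Vec N) : fro (fun i => c • A i) = |c| * fro A := by
  simp only [fro_eq_norm]
  exact norm_smul c (WithLp.toLp 2 A)

lemma fro_sub_le (A B : Fin n → Vec N) : fro (fun i => A i - B i) ≤ fro A + fro B := by
  simp only [fro_eq_norm]
  exact norm_sub_le (WithLp.toLp 2 A) (WithLp.toLp 2 B)

lemma fro_le_fro_of_norm_le {A B : Fin n → Vec N} (h : ∀ i, ‖A i‖ ≤ ‖B i‖) : fro A ≤ fro B :=
  Real.sqrt_le_sqrt (Finset.sum_le_sum fun i _ => by gcongr; exact h i)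

lemma norm_le_fro (A : Fin n → Vec N) (i : Fin n) : ‖A i‖ ≤ fro A := by
  rw [fro_eq_norm]
  exact PiLp.norm_apply_le (WithLp.toLp 2 A) i

lemma sum_sub_mean (hn : 0 < n) {A : Fin n → Vec N} {m : Vec N}
    (hm : m = (n : ℝ)⁻¹ • ∑ i, A i) : ∑ i, (A i - m) = 0 := by
  have : (n : ℝ) ≠ 0 := by positivity
  rw [Finset.sum_sub_distrib, hm]
  simp [← Nat.cast_smul_eq_nsmul ℝ, smul_smul, this]

lemma sum_norm_sub_sq (hn : 0 < n) {A : Fin n → Vec N} {m : Vec N}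
    (hm : m = (n : ℝ)⁻¹ • ∑ i, A i) (w : Vec N) :
    ∑ i, ‖w - A i‖ ^ 2 = n * ‖w - m‖ ^ 2 + fro (fun i => A i - m) ^ 2 := by
  have h (i : Fin n) : ‖w - A i‖ ^ 2 =
      ‖w - m‖ ^ 2 - 2 * ⟪w - m, A i - m⟫ + ‖A i - m‖ ^ 2 := by
    rw [← norm_sub_sq_real, sub_sub_sub_cancel_right]
  simp_rw [h, fro_sq]
  rw [Finset.sum_add_distrib, Finset.sum_sub_distrib, ← Finset.mul_sum, ← inner_sum,
    sum_sub_mean hn hm]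
  simp

lemma fro_sub_mean_le (hn : 0 < n) {A : Fin n → Vec N} {m : Vec N}
    (hm : m = (n : ℝ)⁻¹ • ∑ i, A i) : fro (fun i => A i - m) ≤ fro A := by
  have h := sum_norm_sub_sq hn hm 0
  simp only [zero_sub, norm_neg] at h
  rw [← fro_sq A] at h
  have : 0 ≤ n * ‖m‖ ^ 2 := by positivity
  exact (sq_le_sq₀ (fro_nonneg _) (fro_nonneg _)).1 (by linarith)

lemma fro_matrix_mul_le (M : Matrix (Fin n) (Fin n) ℝ) (A : Fin n → Vec N) :
    fro (fun i => ∑ j, M i j • A j) ≤ specNorm M * fro A := by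
  have h0 : 0 ≤ specNorm M := norm_nonneg _
  rw [← sq_le_sq₀ (fro_nonneg _) (mul_nonneg h0 (fro_nonneg A))]
  have hsq (B : Fin n → Vec N) :
      fro B ^ 2 = ∑ c, ‖(WithLp.toLp 2 (fun i => B i c) : EuclideanSpace ℝ (Fin n))‖ ^ 2 := by
    simp_rw [fro_sq, EuclideanSpace.norm_sq_eq]
    exact Finset.sum_comm
  rw [mul_pow, hsq, hsq, Finset.mul_sum]
  refine Finset.sum_le_sum fun c _ => ?_
  rw [← mul_pow]
  gcongr
  have := (LinearMap.toContinuousLinearMap (Matrix.toEuclideanLin M)).le_opNorm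
    (WithLp.toLp 2 (fun i => A i c))
  refine le_of_eq_of_le (congrArg norm ?_) this
  ext i
  simp [Matrix.mulVec, dotProduct]

/-- Mixing by a doubly stochastic matrix contracts the deviation from the mean. -/
lemma fro_mix_sub_mean_le (hn : 0 < n) {W : Matrix (Fin n) (Fin n) ℝ}
    (hW : ∀ i, ∑ j, W i j = 1) {A : Fin n → Vec N} {m : Vec N}
    (hm : m = (n : ℝ)⁻¹ • ∑ i, A i) :
    fro (fun i => ∑ j, W i j • A j - m) ≤
      specNorm (W - (n : ℝ)⁻¹ • Matrix.of (fun _ _ => (1 : ℝ))) * fro (fun i => A i - m) := by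
  convert fro_matrix_mul_le (W - (n : ℝ)⁻¹ • Matrix.of (fun _ _ => (1 : ℝ)))
    (fun i => A i - m) using 3 with i
  simp only [Matrix.sub_apply, Matrix.smul_apply, Matrix.of_apply, smul_eq_mul, mul_one, sub_smul,
    Finset.sum_sub_distrib]
  rw [← Finset.smul_sum, sum_sub_mean hn hm]
  simp [smul_sub, ← Finset.sum_smul, hW]

end Frobenius

section GradientTracking

variable {n N : ℕ}

lemma sum_inexact_gradient_step (hn : 0 < n) {β η : ℝ} (hη : 0 < η) {f : Fin n → Vec N → ℝ}
    {x G : Fin n → Vec N} {m g : Vec N}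
    (hup : ∀ i w, f i w ≤ f i (x i) + ⟪G i, w - x i⟫ + β / 2 * ‖w - x i‖ ^ 2)
    (hlow : ∀ i w, f i (x i) + ⟪G i, w - x i⟫ ≤ f i w)
    (hm : m = (n : ℝ)⁻¹ • ∑ i, x i) (hg : g = (n : ℝ)⁻¹ • ∑ i, G i) (z : Vec N) :
    ∑ i, f i (m - η • g) - ∑ i, f i z ≤
      n * ‖m - z‖ ^ 2 / (2 * η) - n * ‖m - η • g - z‖ ^ 2 / (2 * η)
        - n * (η / 2 * (1 - β * η)) * ‖g‖ ^ 2 + β / 2 * fro (fun i => x i - m) ^ 2 := by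
  have hn0 : (n : ℝ) ≠ 0 := by positivity
  set w := m - η • g with hw
  have h1 (i : Fin n) : f i w - f i z ≤ ⟪G i, w - z⟫ + β / 2 * ‖w - x i‖ ^ 2 := by
    have h : ⟪G i, w - x i⟫ - ⟪G i, z - x i⟫ = ⟪G i, w - z⟫ := by
      rw [← inner_sub_right, sub_sub_sub_cancel_right]
    linarith [hup i w, hlow i z]
  have h2 := Finset.sum_le_sum fun i (_ : i ∈ Finset.univ) => h1 i
  have hG : ∑ i, G i = (n : ℝ) • g := by rw [hg, smul_smul, mul_inv_cancel₀ hn0, one_smul]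
  rw [Finset.sum_sub_distrib, Finset.sum_add_distrib, ← sum_inner, ← Finset.mul_sum,
    sum_norm_sub_sq hn hm, hG, real_inner_smul_left] at h2
  have h3 : ‖w - m‖ ^ 2 = η ^ 2 * ‖g‖ ^ 2 := by
    rw [hw, sub_sub_cancel_left, norm_neg, norm_smul, mul_pow, Real.norm_eq_abs, sq_abs]
  have h4 : ⟪g, w - z⟫ = ⟪g, m - z⟫ - η * ‖g‖ ^ 2 := by
    rw [hw, sub_right_comm, inner_sub_right, real_inner_smul_right, real_inner_self_eq_norm_sq]
  have h5 : ‖w - z‖ ^ 2 = ‖m - z‖ ^ 2 - 2 * η * ⟪g, m - z⟫ + η ^ 2 * ‖g‖ ^ 2 := by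
    rw [hw, sub_right_comm, norm_sub_sq_real, real_inner_smul_right, norm_smul, mul_pow,
      Real.norm_eq_abs, sq_abs, real_inner_comm]
    ring
  rw [h3, h4] at h2
  refine h2.trans_eq ?_
  rw [h5]
  field_simp
  ring

lemma sq_convex_step {σ a b : ℝ} (hσ0 : 0 < σ) (hσ1 : σ < 1) :
    (σ * a + b) ^ 2 ≤ σ * a ^ 2 + b ^ 2 / (1 - σ) := by
  have hδ : 0 < 1 - σ := by linarith
  have h : σ * a ^ 2 + b ^ 2 / (1 - σ) - (σ * a + b) ^ 2 =
      σ / (1 - σ) * ((1 - σ) * a - b) ^ 2 := by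
    field_simp
    ring
  have : 0 ≤ σ / (1 - σ) * ((1 - σ) * a - b) ^ 2 := by positivity
  linarith

/-- Dissipation of the weighted consensus and tracking errors along one iteration. -/
lemma tracking_energy_step {σ β η X X' S S' u : ℝ} (hσ0 : 0 < σ) (hσ1 : σ < 1) (hβ : 0 < β)
    (hη0 : 0 < η) (hη : η ≤ (1 - σ) ^ 2 / (160 * β)) (hX' : 0 ≤ X') (hS' : 0 ≤ S')
    (hX : X' ≤ σ * X + η * S) (hS : S' ≤ σ * S + β * (2 * X + η * S + η * u)) :
    2 * β / (1 - σ) * X' ^ 2 + (1 - σ) / (24 * β) * S' ^ 2 + 3 / 2 * β * X ^ 2 ≤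
      2 * β / (1 - σ) * X ^ 2 + (1 - σ) / (24 * β) * S ^ 2 + β * η ^ 2 / 8 * u ^ 2 := by
  set δ := 1 - σ with hδdef
  have hδ : 0 < δ := by linarith
  have hδ1 : δ < 1 := by linarith
  have hX2 : X' ^ 2 ≤ σ * X ^ 2 + (η * S) ^ 2 / δ :=
    (pow_le_pow_left₀ hX' hX 2).trans (sq_convex_step hσ0 hσ1)
  have hS2 : S' ^ 2 ≤ σ * S ^ 2 + 3 * β ^ 2 * (4 * X ^ 2 + η ^ 2 * S ^ 2 + η ^ 2 * u ^ 2) / δ := by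
    refine ((pow_le_pow_left₀ hS' hS 2).trans (sq_convex_step hσ0 hσ1)).trans ?_
    gcongr
    rw [mul_pow, mul_comm 3, mul_assoc]
    gcongr
    nlinarith [sq_nonneg (2 * X - η * S), sq_nonneg (2 * X - η * u), sq_nonneg (η * S - η * u)]
  have hβη : β * η ≤ δ ^ 2 / 160 := by
    rw [le_div_iff₀ (by positivity)] at hη
    linarith
  have hX3 := mul_le_mul_of_nonneg_left hX2 (show 0 ≤ 2 * β / δ by positivity)
  have hS3 := mul_le_mul_of_nonneg_left hS2 (show 0 ≤ δ / (24 * β) by positivity)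
  have e1 : 2 * β / δ * (σ * X ^ 2 + (η * S) ^ 2 / δ) =
      2 * β / δ * X ^ 2 - 2 * β * X ^ 2 + 2 * (β * η) ^ 2 / (δ ^ 2 * β) * S ^ 2 := by
    rw [show σ = 1 - δ by linarith]
    field_simp
  have e2 : δ / (24 * β) *
      (σ * S ^ 2 + 3 * β ^ 2 * (4 * X ^ 2 + η ^ 2 * S ^ 2 + η ^ 2 * u ^ 2) / δ) =
      δ / (24 * β) * S ^ 2 - δ ^ 2 / (24 * β) * S ^ 2 + β / 2 * X ^ 2
        + (β * η) ^ 2 / (8 * β) * S ^ 2 + β * η ^ 2 / 8 * u ^ 2 := by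
    rw [show σ = 1 - δ by linarith]
    field_simp
    ring
  have e3 : 2 * (β * η) ^ 2 / (δ ^ 2 * β) + (β * η) ^ 2 / (8 * β) ≤ δ ^ 2 / (24 * β) := by
    have h1 : (β * η) ^ 2 ≤ (δ ^ 2 / 160) ^ 2 := by gcongr
    calc 2 * (β * η) ^ 2 / (δ ^ 2 * β) + (β * η) ^ 2 / (8 * β)
        ≤ 2 * (δ ^ 2 / 160) ^ 2 / (δ ^ 2 * β) + (δ ^ 2 / 160) ^ 2 / (8 * β) := by gcongr
      _ = (2 / 25600 + δ ^ 2 / 204800) * (δ ^ 2 / β) := by field_simp; ring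
      _ ≤ 1 / 24 * (δ ^ 2 / β) := by
        gcongr
        nlinarith
      _ = δ ^ 2 / (24 * β) := by field_simp
  have e4 := mul_le_mul_of_nonneg_right e3 (sq_nonneg S)
  rw [add_mul] at e4
  linarith

/-- The mixing matrix is not `1 × 1` when its deviation from averaging is nonzero. -/
lemma two_le_of_specNorm_pos (hn : 0 < n) {W : Matrix (Fin n) (Fin n) ℝ}
    (hW : ∀ i, ∑ j, W i j = 1)
    (h : 0 < specNorm (W - (n : ℝ)⁻¹ • Matrix.of (fun _ _ => (1 : ℝ)))) : 2 ≤ n := by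
  by_contra hlt
  obtain rfl : n = 1 := by omega
  have h0 : W - ((1 : ℕ) : ℝ)⁻¹ • Matrix.of (fun _ _ => (1 : ℝ)) = 0 := by
    ext i j
    have := hW i
    rw [Fin.sum_univ_one] at this
    simp [Subsingleton.elim j 0, this]
  rw [h0] at h
  simp [specNorm] at h

lemma mean_mix {W : Matrix (Fin n) (Fin n) ℝ} (hW : ∀ j, ∑ i, W i j = 1)
    (A : Fin n → Vec N) : ∑ i, ∑ j, W i j • A j = ∑ j, A j := by
  rw [Finset.sum_comm]
  simp_rw [← Finset.sum_smul, hW, one_smul]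

lemma ConvexOn.map_range_average_le {E : Type*} [AddCommGroup E] [Module ℝ E] {F : E → ℝ}
    (hF : ConvexOn ℝ Set.univ F) (y : ℕ → E) (t : ℕ) :
    F (((t : ℝ) + 1)⁻¹ • ∑ k ∈ Finset.range (t + 1), y k) ≤
      ((t : ℝ) + 1)⁻¹ * ∑ k ∈ Finset.range (t + 1), F (y k) := by
  have ht : (t : ℝ) + 1 ≠ 0 := by positivity
  have h := hF.map_sum_le (t := Finset.range (t + 1)) (w := fun _ => ((t : ℝ) + 1)⁻¹) (p := y)
    (fun _ _ => by positivity) (by simp [ht]) (fun _ _ => Set.mem_univ _)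
  simpa [Finset.smul_sum, Finset.mul_sum] using h

end GradientTracking

theorem statement13
    {n N : ℕ} (hn : 0 < n)
    (β : ℝ) (hβ : 0 < β)
    (f : Fin n → Vec N → ℝ)
    (hcvx : ∀ i, ConvexOn ℝ Set.univ (f i))
    (hdiff : ∀ i, Differentiable ℝ (f i))
    (hsmooth : ∀ i, ∀ u v : Vec N,
      ‖gradient (f i) u - gradient (f i) v‖ ≤ β * ‖u - v‖)
    (favg : Vec N → ℝ) (hfavg : ∀ z, favg z = (n : ℝ)⁻¹ * ∑ i, f i z)
    (xstar : Vec N) (hmin : ∀ z, favg xstar ≤ favg z)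
    (W : Matrix (Fin n) (Fin n) ℝ)
    (hWnonneg : ∀ i j, 0 ≤ W i j)
    (hWrow : ∀ i, ∑ j, W i j = 1)
    (hWcol : ∀ j, ∑ i, W i j = 1)
    (σ : ℝ)
    (hσ : σ = specNorm (W - (n : ℝ)⁻¹ • Matrix.of (fun _ _ => (1 : ℝ))))
    (hσ0 : 0 < σ) (hσ1 : σ < 1)
    (η : ℝ) (hη0 : 0 < η) (hη1 : η ≤ (1 - σ) ^ 2 / (160 * β))
    (x s : ℕ → Fin n → Vec N)
    (hs0 : ∀ i, s 0 i = gradient (f i) (x 0 i))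
    (hxupd : ∀ t i, x (t + 1) i = (∑ j, W i j • x t j) - η • s t i)
    (hsupd : ∀ t i, s (t + 1) i =
      (∑ j, W i j • s t j) + gradient (f i) (x (t + 1) i) - gradient (f i) (x t i))
    (xbar g : ℕ → Vec N)
    (hxbar : ∀ t, xbar t = (n : ℝ)⁻¹ • ∑ i, x t i)
    (hg : ∀ t, g t = (n : ℝ)⁻¹ • ∑ i, gradient (f i) (x t i))
    (xhat : Fin n → ℕ → Vec N)
    (hxhat : ∀ i t, xhat i (t + 1) = ((t : ℝ) + 1)⁻¹ • ∑ k ∈ Finset.range (t + 1), x (k + 1) i) :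
    ∀ (i : Fin n) (t : ℕ),
      favg (xhat i (t + 1)) - favg xstar ≤
        ((t : ℝ) + 1)⁻¹ *
          ((n : ℝ) * ‖xbar 0 - xstar‖ ^ 2 / (2 * η) +
            36 * β / (1 - σ) ^ 2 *
              ((1 / β) * fro (fun i => s 0 i - g 0) +
                2 * fro (fun i => x 0 i - xbar 0)) ^ 2) := by
  intro i t
  have hn0 : (n : ℝ) ≠ 0 := by positivity
  have hn2 : (2 : ℝ) ≤ n := by
    exact_mod_cast two_le_of_specNorm_pos hn hWrow (hσ ▸ hσ0)
  have hδ : 0 < 1 - σ := by linarith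
  have hβη : β * η ≤ (1 - σ) ^ 2 / 160 := by
    rw [le_div_iff₀ (by positivity)] at hη1
    linarith
  have hup (i : Fin n) (v w : Vec N) := le_add_inner_gradient_add_sq (hdiff i) (hsmooth i) v w
  have hlow (i : Fin n) (v w : Vec N) := (hcvx i).add_inner_gradient_le (hdiff i) v w
  have hsum (z : Vec N) : ∑ i, f i z = n * favg z := by
    rw [hfavg, mul_inv_cancel_left₀ hn0]
  have hcvx_avg : ConvexOn ℝ Set.univ favg := by
    have h : ConvexOn ℝ Set.univ (fun z => ∑ i, f i z) := by
      refine ⟨convex_univ, fun u _ v _ a b ha hb hab => ?_⟩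
      rw [Finset.smul_sum, Finset.smul_sum, ← Finset.sum_add_distrib]
      exact Finset.sum_le_sum fun i _ => (hcvx i).2 trivial trivial ha hb hab
    rw [show favg = fun z => (n : ℝ)⁻¹ • ∑ i, f i z from funext hfavg]
    exact h.smul (by positivity)
  have hsmooth_avg (z w : Vec N) : favg w ≤
      favg z + ⟪(n : ℝ)⁻¹ • ∑ i, gradient (f i) z, w - z⟫ + β / 2 * ‖w - z‖ ^ 2 := by
    have h := Finset.sum_le_sum fun i (_ : i ∈ Finset.univ) => hup i z w
    rw [Finset.sum_add_distrib, Finset.sum_add_distrib, hsum, hsum, ← sum_inner,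
      Finset.sum_const, Finset.card_univ, Fintype.card_fin, nsmul_eq_mul] at h
    have h' := mul_le_mul_of_nonneg_left h (show 0 ≤ (n : ℝ)⁻¹ by positivity)
    rw [mul_add, mul_add, inv_mul_cancel_left₀ hn0, inv_mul_cancel_left₀ hn0,
      inv_mul_cancel_left₀ hn0] at h'
    rwa [real_inner_smul_left]
  have hsmean (k : ℕ) : g k = (n : ℝ)⁻¹ • ∑ i, s k i := by
    rw [hg]
    congr 1
    induction k with
    | zero => simp_rw [hs0]
    | succ k ih =>
      simp_rw [hsupd, Finset.sum_sub_distrib, Finset.sum_add_distrib]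
      rw [mean_mix hWcol, ih]
      abel
  have hxbar_succ (k : ℕ) : xbar (k + 1) = xbar k - η • g k := by
    rw [hxbar, hxbar, hsmean]
    simp_rw [hxupd, Finset.sum_sub_distrib]
    rw [mean_mix hWcol, ← Finset.smul_sum, smul_sub, smul_comm η]
  set X : ℕ → ℝ := fun k => fro (fun i => x k i - xbar k) with hXdef
  set S : ℕ → ℝ := fun k => fro (fun i => s k i - g k) with hSdef
  have hX0 (k : ℕ) : 0 ≤ X k := fro_nonneg _
  have hS0 (k : ℕ) : 0 ≤ S k := fro_nonneg _
  have hmixx (k : ℕ) : fro (fun i => ∑ j, W i j • x k j - xbar k) ≤ σ * X k :=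
    hσ ▸ fro_mix_sub_mean_le hn hWrow (hxbar k)
  have hmixs (k : ℕ) : fro (fun i => ∑ j, W i j • s k j - g k) ≤ σ * S k :=
    hσ ▸ fro_mix_sub_mean_le hn hWrow (hsmean k)
  have hXstep (k : ℕ) : X (k + 1) ≤ σ * X k + η * S k := by
    have h : (fun i => x (k + 1) i - xbar (k + 1)) =
        fun i => (∑ j, W i j • x k j - xbar k) - η • (s k i - g k) := by
      funext i
      rw [hxupd, hxbar_succ, smul_sub]
      abel
    simp only [hXdef]
    rw [h]
    refine (fro_sub_le _ _).trans (add_le_add (hmixx k) ?_)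
    rw [fro_smul, abs_of_pos hη0]
  have hdist (k : ℕ) : fro (fun i => x (k + 1) i - x k i) ≤
      2 * X k + η * S k + η * (Real.sqrt n * ‖g k‖) := by
    have h : (fun i => x (k + 1) i - x k i) =
        fun i => (((∑ j, W i j • x k j - xbar k) - (x k i - xbar k)) - η • (s k i - g k))
          - η • g k := by
      funext i
      rw [hxupd, smul_sub]
      abel
    have hconst : fro (fun _ : Fin n => g k) = Real.sqrt n * ‖g k‖ := by
      simp [fro]
    rw [h]
    refine (fro_sub_le _ _).trans (add_le_add ((fro_sub_le _ _).trans (add_le_add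
      ((fro_sub_le _ _).trans ?_) ?_)) ?_)
    · change _ + X k ≤ _
      nlinarith [hmixx k, hX0 k]
    · rw [fro_smul, abs_of_pos hη0]
    · rw [fro_smul, abs_of_pos hη0, hconst]
  have hSstep (k : ℕ) : S (k + 1) ≤
      σ * S k + β * (2 * X k + η * S k + η * (Real.sqrt n * ‖g k‖)) := by
    have h : (fun i => s (k + 1) i - g (k + 1)) =
        fun i => (∑ j, W i j • s k j - g k) +
          ((gradient (f i) (x (k + 1) i) - gradient (f i) (x k i)) - (g (k + 1) - g k)) := by
      funext i
      rw [hsupd]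
      abel
    have hgrad : fro (fun i => gradient (f i) (x (k + 1) i) - gradient (f i) (x k i)) ≤
        β * fro (fun i => x (k + 1) i - x k i) := by
      refine le_trans ?_ (fro_smul β _ |>.trans (by rw [abs_of_pos hβ])).le
      refine fro_le_fro_of_norm_le fun i => ?_
      rw [norm_smul, Real.norm_of_nonneg hβ.le]
      exact hsmooth i _ _
    simp only [hSdef]
    rw [h]
    refine (fro_add_le _ _).trans (add_le_add (hmixs k) ((fro_sub_mean_le hn ?_).trans
      (hgrad.trans (mul_le_mul_of_nonneg_left (hdist k) hβ.le))))
    rw [hg, hg, Finset.sum_sub_distrib, smul_sub]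
  set Φ : ℕ → ℝ := fun k => n * ‖xbar k - xstar‖ ^ 2 / (2 * η) +
    (2 * β / (1 - σ) * X k ^ 2 + (1 - σ) / (24 * β) * S k ^ 2) - β * X k ^ 2 with hΦ
  have hcoef : 2 * β ≤ 2 * β / (1 - σ) := by
    rw [le_div_iff₀ hδ]
    nlinarith
  have hstep (k : ℕ) : favg (x (k + 1) i) - favg xstar ≤ Φ k - Φ (k + 1) := by
    have h1 := sub_min_le_two_mul_add_sq hβ (hsmooth_avg (xbar (k + 1))) hmin (x (k + 1) i)
    have h2 := sum_inexact_gradient_step hn hη0 (fun i w => hup i (x k i) w)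
      (fun i w => hlow i (x k i) w) (hxbar k) (hg k) xstar
    rw [← hxbar_succ, hsum, hsum, ← mul_sub] at h2
    have h3 := tracking_energy_step hσ0 hσ1 hβ hη0 hη1 (hX0 (k + 1)) (hS0 (k + 1))
      (hXstep k) (hSstep k)
    rw [mul_pow, Real.sq_sqrt (Nat.cast_nonneg n)] at h3
    have h4 : ‖x (k + 1) i - xbar (k + 1)‖ ^ 2 ≤ X (k + 1) ^ 2 := by
      gcongr
      exact norm_le_fro (fun i => x (k + 1) i - xbar (k + 1)) i
    have h5 : 2 * (favg (xbar (k + 1)) - favg xstar) ≤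
        n * (favg (xbar (k + 1)) - favg xstar) :=
      mul_le_mul_of_nonneg_right hn2 (by linarith [hmin (xbar (k + 1))])
    have h6 : β * η ^ 2 / 8 * (n * ‖g k‖ ^ 2) ≤ n * (η / 2 * (1 - β * η)) * ‖g k‖ ^ 2 := by
      have : β * η ^ 2 / 8 ≤ η / 2 * (1 - β * η) := by
        have h : β * η ≤ 1 / 160 := hβη.trans (by nlinarith)
        nlinarith [mul_le_mul_of_nonneg_right h hη0.le]
      calc _ ≤ η / 2 * (1 - β * η) * (n * ‖g k‖ ^ 2) := by gcongr
        _ = _ := by ring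
    have h7 := mul_le_mul_of_nonneg_left h4 hβ.le
    simp only [hΦ]
    change n * (favg (xbar (k + 1)) - favg xstar) ≤ _ - _ - _ + β / 2 * X k ^ 2 at h2
    linarith
  have htel : ∑ k ∈ Finset.range (t + 1), (favg (x (k + 1) i) - favg xstar) ≤
      Φ 0 - Φ (t + 1) := by
    rw [← Finset.sum_range_sub' Φ]
    exact Finset.sum_le_sum fun k _ => hstep k
  have hΦ_nonneg : 0 ≤ Φ (t + 1) := by
    have h1 := mul_le_mul_of_nonneg_right hcoef (sq_nonneg (X (t + 1)))
    have h2 : 0 ≤ n * ‖xbar (t + 1) - xstar‖ ^ 2 / (2 * η) := by positivity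
    have h3 : 0 ≤ (1 - σ) / (24 * β) * S (t + 1) ^ 2 := by positivity
    have h4 : 0 ≤ β * X (t + 1) ^ 2 := by positivity
    simp only [hΦ]
    linarith
  have hΦ_zero : Φ 0 ≤ n * ‖xbar 0 - xstar‖ ^ 2 / (2 * η) +
      36 * β / (1 - σ) ^ 2 * ((1 / β) * S 0 + 2 * X 0) ^ 2 := by
    have hβX : 0 ≤ β * X 0 ^ 2 := by positivity
    have h1 : 2 * β / (1 - σ) ≤ 36 * β / (1 - σ) ^ 2 * 4 := by
      rw [div_mul_eq_mul_div, div_le_div_iff₀ hδ (by positivity)]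
      nlinarith [mul_pos hβ hδ]
    have h2 : (1 - σ) / (24 * β) ≤ 36 * β / (1 - σ) ^ 2 * (1 / β) ^ 2 := by
      rw [show 36 * β / (1 - σ) ^ 2 * (1 / β) ^ 2 = 36 / ((1 - σ) ^ 2 * β) by field_simp,
        div_le_div_iff₀ (by positivity) (by positivity)]
      have : (1 - σ) ^ 3 ≤ 1 := pow_le_one₀ hδ.le (by linarith)
      nlinarith
    have h3 := mul_le_mul_of_nonneg_right h1 (sq_nonneg (X 0))
    have h4 := mul_le_mul_of_nonneg_right h2 (sq_nonneg (S 0))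
    have h5 : 0 ≤ 36 * β / (1 - σ) ^ 2 * (4 * ((1 / β) * S 0 * X 0)) := by
      have := hX0 0
      have := hS0 0
      positivity
    simp only [hΦ]
    linarith
  calc favg (xhat i (t + 1)) - favg xstar
      ≤ ((t : ℝ) + 1)⁻¹ * ∑ k ∈ Finset.range (t + 1), favg (x (k + 1) i) - favg xstar := by
        rw [hxhat]
        gcongr
        exact hcvx_avg.map_range_average_le (fun k => x (k + 1) i) t
    _ = ((t : ℝ) + 1)⁻¹ * ∑ k ∈ Finset.range (t + 1), (favg (x (k + 1) i) - favg xstar) := by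
        have : (t : ℝ) + 1 ≠ 0 := by positivity
        rw [Finset.sum_sub_distrib, mul_sub]
        simp [this]
    _ ≤ _ := by
        gcongr
        linarith
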